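/- arXiv:1605.08224 — 3 statements merged into one kernel-verified Lean document; each statement's English description precedes it below -/
import Mathlib

section
/- Let λ ≥ 0 and t ∈ (√2/2, 1], and let f ∈ H_Σ(λ,t) have Taylor coefficients aₙ = f⁽ⁿ⁾(0)/n!. Then |a₃| ≤ 4t²/(1+λ)² + t/(1+2λ). -/
/-- The open unit disk in ℂ. -/
def unitD : Set ℂ := {z : ℂ | ‖z‖ < 1}

/-- The generating function `H(z,t) = 1 / (1 - 2 t z + z²)`. -/
noncomputable def Hker (t : ℝ) (z : ℂ) : ℂ := 1 / (1 - 2 * (t : ℂ) * z + z ^ 2)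

/-- `F` is subordinate to `H(·, t)` on the unit disk. -/
def SubordH (t : ℝ) (F : ℂ → ℂ) : Prop :=
  ∃ ω : ℂ → ℂ, AnalyticOnNhd ℂ ω unitD ∧ ω 0 = 0 ∧ (∀ z ∈ unitD, ‖ω z‖ < 1) ∧
    ∀ z ∈ unitD, F z = Hker t (ω z)

/-- The expression `(1-λ) z f'(z)/f(z) + λ (1 + z f''(z)/f'(z))`. -/
noncomputable def exprH (lam : ℝ) (f : ℂ → ℂ) (z : ℂ) : ℂ :=
  (1 - (lam : ℂ)) * (z * deriv f z / f z) +
    (lam : ℂ) * (1 + z * deriv (deriv f) z / deriv f z)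

/-- The analytic extension (with value 1 at 0) of `exprH lam f` is subordinate to `H(·,t)`. -/
def SubordExprH (lam t : ℝ) (f : ℂ → ℂ) : Prop :=
  ∃ F : ℂ → ℂ, AnalyticOnNhd ℂ F unitD ∧ F 0 = 1 ∧
    (∀ z ∈ unitD, z ≠ 0 → F z = exprH lam f z) ∧ SubordH t F

/-- `f` is bi-univalent on the unit disk with (bi-univalent) inverse `g`. -/
def BiUnivalentWithInv (f g : ℂ → ℂ) : Prop :=
  AnalyticOnNhd ℂ f unitD ∧ f 0 = 0 ∧ deriv f 0 = 1 ∧ Set.InjOn f unitD ∧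
  AnalyticOnNhd ℂ g unitD ∧ Set.InjOn g unitD ∧
  (∀ z ∈ unitD, f z ∈ unitD → g (f z) = z) ∧
  (∀ w ∈ unitD, g w ∈ unitD → f (g w) = w)

/-- The class `H_Σ(λ, t)`. -/
def InHSigma (lam t : ℝ) (f : ℂ → ℂ) : Prop :=
  ∃ g : ℂ → ℂ, BiUnivalentWithInv f g ∧ SubordExprH lam t f ∧ SubordExprH lam t g

/-- `f` agrees near `0` with the cubic polynomial `a + b z + c z² + d z³` up to `z⁴` times a
function continuous at `0`. -/
def HasCubicJet (f : ℂ → ℂ) (a b c d : ℂ) : Prop :=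
  ∃ R : ℂ → ℂ, ContinuousAt R 0 ∧
    ∀ᶠ z in nhds 0, f z = a + b * z + c * z ^ 2 + d * z ^ 3 + z ^ 4 * R z

lemma eq_zero_of_eventually_const_add_mul_eq_zero {A : ℂ} {S : ℂ → ℂ} (hS : ContinuousAt S 0)
    (h : ∀ᶠ z in nhdsWithin 0 {0}ᶜ, A + z * S z = 0) :
    A = 0 ∧ ∀ᶠ z in nhdsWithin 0 {0}ᶜ, S z = 0 := by
  have hc : ContinuousAt (fun z : ℂ ↦ A + z * S z) 0 := by fun_prop
  have hlim : Filter.Tendsto (fun z : ℂ ↦ A + z * S z) (nhdsWithin 0 {0}ᶜ) (nhds A) := by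
    simpa using hc.tendsto.mono_left nhdsWithin_le_nhds
  have hA : A = 0 :=
    tendsto_nhds_unique hlim (tendsto_const_nhds.congr' (h.mono fun z hz ↦ hz.symm))
  refine ⟨hA, ?_⟩
  filter_upwards [h, self_mem_nhdsWithin] with z hz hz0
  simpa [hA, show z ≠ 0 from hz0] using hz

namespace HasCubicJet

variable {f g : ℂ → ℂ} {a b c d a' b' c' d' : ℂ}

lemma congr (hf : HasCubicJet f a b c d) (h : ∀ᶠ z in nhds 0, g z = f z) :
    HasCubicJet g a b c d := by
  obtain ⟨R, hR, hf⟩ := hf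
  refine ⟨R, hR, ?_⟩
  filter_upwards [hf, h] with z hz hz'
  rw [hz', hz]

lemma const (a : ℂ) : HasCubicJet (fun _ ↦ a) a 0 0 0 :=
  ⟨0, continuousAt_const, by simp⟩

lemma self : HasCubicJet (fun z ↦ z) 0 1 0 0 :=
  ⟨0, continuousAt_const, by simp⟩

lemma add (hf : HasCubicJet f a b c d) (hg : HasCubicJet g a' b' c' d') :
    HasCubicJet (fun z ↦ f z + g z) (a + a') (b + b') (c + c') (d + d') := by
  obtain ⟨R, hR, hf⟩ := hf
  obtain ⟨S, hS, hg⟩ := hg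
  refine ⟨fun z ↦ R z + S z, by fun_prop, ?_⟩
  filter_upwards [hf, hg] with z hz hz'
  rw [hz, hz']
  ring

lemma mul (hf : HasCubicJet f a b c d) (hg : HasCubicJet g a' b' c' d') :
    HasCubicJet (fun z ↦ f z * g z) (a * a') (a * b' + b * a') (a * c' + b * b' + c * a')
      (a * d' + b * c' + c * b' + d * a') := by
  obtain ⟨R, hR, hf⟩ := hf
  obtain ⟨S, hS, hg⟩ := hg
  refine ⟨fun z ↦ (b * d' + c * c' + d * b') + (c * d' + d * c') * z + d * d' * z ^ 2 +
    R z * (a' + b' * z + c' * z ^ 2 + d' * z ^ 3) +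
    S z * (a + b * z + c * z ^ 2 + d * z ^ 3) + z ^ 4 * R z * S z, by fun_prop, ?_⟩
  filter_upwards [hf, hg] with z hz hz'
  rw [hz, hz']
  ring

lemma const_mul (k : ℂ) (hf : HasCubicJet f a b c d) :
    HasCubicJet (fun z ↦ k * f z) (k * a) (k * b) (k * c) (k * d) := by
  simpa using (const k).mul hf

lemma pow_two (hf : HasCubicJet f a b c d) :
    HasCubicJet (fun z ↦ f z ^ 2) (a * a) (a * b + b * a) (a * c + b * b + c * a)
      (a * d + b * c + c * b + d * a) := by
  simpa [sq] using hf.mul hf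

lemma unique (hf : HasCubicJet f a b c d) (hg : HasCubicJet f a' b' c' d') :
    a = a' ∧ b = b' ∧ c = c' ∧ d = d' := by
  obtain ⟨R, hR, hf⟩ := hf
  obtain ⟨S, hS, hg⟩ := hg
  have h : ∀ᶠ z in nhdsWithin 0 {0}ᶜ, (a - a') + z * ((b - b') + z * ((c - c') +
      z * ((d - d') + z * (R z - S z)))) = 0 := by
    filter_upwards [nhdsWithin_le_nhds hf, nhdsWithin_le_nhds hg] with z hz hz'
    linear_combination hz' - hz
  obtain ⟨ha, h⟩ := eq_zero_of_eventually_const_add_mul_eq_zero (by fun_prop) h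
  obtain ⟨hb, h⟩ := eq_zero_of_eventually_const_add_mul_eq_zero (by fun_prop) h
  obtain ⟨hc, h⟩ := eq_zero_of_eventually_const_add_mul_eq_zero (by fun_prop) h
  obtain ⟨hd, -⟩ := eq_zero_of_eventually_const_add_mul_eq_zero (by fun_prop) h
  exact ⟨sub_eq_zero.1 ha, sub_eq_zero.1 hb, sub_eq_zero.1 hc, sub_eq_zero.1 hd⟩

lemma comp (hg : HasCubicJet g a' b' c' d') (hf : HasCubicJet f 0 b c d)
    (hf₀ : Filter.Tendsto f (nhds 0) (nhds 0)) :
    HasCubicJet (fun z ↦ g (f z)) a' (b' * b) (b' * c + c' * b ^ 2)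
      (b' * d + 2 * c' * b * c + d' * b ^ 3) := by
  obtain ⟨S, hS, hg⟩ := hg
  obtain ⟨R, hR, hf'⟩ := hf.congr (.of_forall fun _ ↦ rfl)
  have hf₀' : f 0 = 0 := by simpa using hf'.self_of_nhds
  have hfc : ContinuousAt f 0 := by rwa [ContinuousAt, hf₀']
  have hSf : ContinuousAt (fun z ↦ S (f z)) 0 :=
    ContinuousAt.comp' (by rwa [hf₀']) hfc
  have hrem : HasCubicJet (fun z ↦ f z ^ 4 * S (f z)) 0 0 0 0 := by
    refine ⟨fun z ↦ (b + c * z + d * z ^ 2 + z ^ 3 * R z) ^ 4 * S (f z),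
      .mul (by fun_prop) hSf, ?_⟩
    filter_upwards [hf'] with z hz
    rw [show f z ^ 4 = (z * (b + c * z + d * z ^ 2 + z ^ 3 * R z)) ^ 4 by rw [hz]; ring]
    ring
  have h := (((const a').add (hf.const_mul b')).add (hf.pow_two.const_mul c')).add
    (((hf.pow_two.mul hf).const_mul d').add hrem)
  have h' := h.congr (g := fun z ↦ g (f z)) (by
    filter_upwards [hf₀.eventually hg] with z hz
    rw [hz]
    ring)
  convert h' using 1 <;> ring

end HasCubicJet

lemma AnalyticAt.hasCubicJet {f : ℂ → ℂ} (hf : AnalyticAt ℂ f 0) :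
    HasCubicJet f (f 0) (deriv f 0) (iteratedDeriv 2 f 0 / 2) (iteratedDeriv 3 f 0 / 6) := by
  have hp := hf.hasFPowerSeriesAt
  have hcoef (n : ℕ) : (dslope · 0)^[n] f 0 = iteratedDeriv n f 0 / n.factorial := by
    rw [← (hp.has_fpower_series_iterate_dslope_fslope n).coeff_zero 1,
      ← FormalMultilinearSeries.coeff_ofScalars (𝕜 := ℂ)
        (p := fun n ↦ iteratedDeriv n f 0 / n.factorial) (n := n)]
    simp
  have hslope (n : ℕ) (z : ℂ) :
      (dslope · 0)^[n] f z = (dslope · 0)^[n] f 0 + z * (dslope · 0)^[n + 1] f z := by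
    have h := sub_smul_dslope ((dslope · 0)^[n] f) 0 z
    rw [Function.iterate_succ_apply']
    simp only [sub_zero, smul_eq_mul] at h
    rw [h]
    ring
  refine ⟨(dslope · 0)^[4] f,
    (hp.has_fpower_series_iterate_dslope_fslope 4).continuousAt, .of_forall fun z ↦ ?_⟩
  have h0 := hslope 0 z
  rw [hslope 1 z, hslope 2 z, hslope 3 z, hcoef, hcoef, hcoef, hcoef] at h0
  simp only [Function.iterate_zero_apply, Nat.reduceAdd, Nat.factorial, iteratedDeriv_zero,
    iteratedDeriv_one] at h0
  rw [h0]
  norm_num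
  ring

lemma HasCubicJet.deriv {f : ℂ → ℂ} {a b c d : ℂ} (h : HasCubicJet f a b c d)
    (hf : AnalyticAt ℂ f 0) : ∃ e, HasCubicJet (deriv f) b (2 * c) (3 * d) e := by
  obtain ⟨-, hb, hc, hd⟩ := h.unique hf.hasCubicJet
  have h' := hf.deriv.hasCubicJet
  have h₂ : iteratedDeriv 2 f 0 = _root_.deriv (_root_.deriv f) 0 := by
    rw [iteratedDeriv_succ', iteratedDeriv_one]
  have h₃ : iteratedDeriv 3 f 0 = iteratedDeriv 2 (_root_.deriv f) 0 := by
    rw [iteratedDeriv_succ']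
  refine ⟨iteratedDeriv 3 (_root_.deriv f) 0 / 6, ?_⟩
  convert h' using 1
  · rw [hc, h₂]
    ring
  · rw [hd, h₃]
    ring

lemma unitD_eq_ball : unitD = Metric.ball 0 1 := by
  ext z
  simp [unitD]

lemma unitD_mem_nhds_zero : unitD ∈ nhds (0 : ℂ) := by
  rw [unitD_eq_ball]
  exact Metric.ball_mem_nhds 0 one_pos

lemma zero_mem_unitD : (0 : ℂ) ∈ unitD := mem_of_mem_nhds unitD_mem_nhds_zero

/-- Cauchy's estimate for the Taylor coefficients of a self-map of the unit disk. -/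
lemma norm_iteratedDeriv_div_factorial_le_one {ω : ℂ → ℂ} (hω : AnalyticOnNhd ℂ ω unitD)
    (hb : ∀ z ∈ unitD, ‖ω z‖ < 1) (n : ℕ) : ‖iteratedDeriv n ω 0 / n.factorial‖ ≤ 1 := by
  have hr : ∀ r ∈ Set.Ioo (0 : ℝ) 1, ‖iteratedDeriv n ω 0 / n.factorial‖ * r ^ n ≤ 1 := by
    intro r hr
    have hsub : Metric.closedBall (0 : ℂ) r ⊆ unitD := by
      rw [unitD_eq_ball]
      exact Metric.closedBall_subset_ball hr.2
    have h := Complex.norm_iteratedDeriv_le_of_forall_mem_sphere_norm_le (f := ω) (c := 0)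
      (C := 1) n hr.1 ((hω.differentiableOn.mono hsub).diffContOnCl_ball subset_rfl)
      fun z hz ↦ (hb z (hsub (Metric.sphere_subset_closedBall hz))).le
    have hrn : 0 < r ^ n := pow_pos hr.1 n
    have hn : (0 : ℝ) < n.factorial := by positivity
    rw [mul_one, le_div_iff₀ hrn] at h
    rw [norm_div, Complex.norm_natCast, div_mul_eq_mul_div, div_le_one hn]
    exact h
  have hlim : Filter.Tendsto (fun r : ℝ ↦ ‖iteratedDeriv n ω 0 / n.factorial‖ * r ^ n)
      (nhdsWithin 1 (Set.Iio 1)) (nhds (‖iteratedDeriv n ω 0 / n.factorial‖ * 1 ^ n)) :=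
    (Continuous.tendsto (by fun_prop) 1).mono_left nhdsWithin_le_nhds
  rw [one_pow, mul_one] at hlim
  exact le_of_tendsto hlim
    (Filter.mem_of_superset (Ioo_mem_nhdsLT (zero_lt_one (α := ℝ))) hr)

/-- The coefficient relations obtained from a subordination to `H(·, t)`. -/
lemma SubordH.exists_coeff {t : ℝ} {F : ℂ → ℂ} (hF : SubordH t F) {p₀ p₁ p₂ p₃ : ℂ}
    (hj : HasCubicJet F p₀ p₁ p₂ p₃) : ∃ c₁ c₂ : ℂ, ‖c₁‖ ≤ 1 ∧ ‖c₂‖ ≤ 1 ∧ p₁ = 2 * t * c₁ ∧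
      p₂ = 2 * t * c₂ + (4 * t ^ 2 - 1) * c₁ ^ 2 := by
  obtain ⟨ω, hω, hω₀, hωb, hFω⟩ := hF
  have hω' := hω 0 zero_mem_unitD
  refine ⟨_, _, norm_iteratedDeriv_div_factorial_le_one hω hωb 1,
    norm_iteratedDeriv_div_factorial_le_one hω hωb 2, ?_⟩
  have hωj := hω'.hasCubicJet
  simp only [iteratedDeriv_one, Nat.factorial_one, Nat.factorial_two, Nat.cast_one, div_one,
    Nat.cast_ofNat]
  rw [hω₀] at hωj
  generalize deriv ω 0 = c₁ at *
  generalize iteratedDeriv 2 ω 0 / 2 = c₂ at *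
  have hden := ((HasCubicJet.const 1).add (hωj.const_mul (-(2 * (t : ℂ))))).add hωj.pow_two
  have hcont : ContinuousAt (fun z ↦ 1 + -(2 * (t : ℂ)) * ω z + ω z ^ 2) 0 := by
    have := hω'.continuousAt
    fun_prop
  have hne : ∀ᶠ z in nhds 0, 1 + -(2 * (t : ℂ)) * ω z + ω z ^ 2 ≠ 0 :=
    hcont.eventually_ne (by simp [hω₀])
  have hone := (HasCubicJet.const 1).congr (g := fun z ↦ F z *
      (1 + -(2 * (t : ℂ)) * ω z + ω z ^ 2)) (by
    filter_upwards [hne, unitD_mem_nhds_zero] with z hz hzD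
    rw [hFω z hzD, Hker, show 1 - 2 * (t : ℂ) * ω z + ω z ^ 2 =
      1 + -(2 * (t : ℂ)) * ω z + ω z ^ 2 by ring, one_div, inv_mul_cancel₀ hz])
  obtain ⟨h0, h1, h2, -⟩ := (hj.mul hden).unique hone
  have hp₀ : p₀ = 1 := by linear_combination h0
  subst hp₀
  have hp₁ : p₁ = 2 * t * c₁ := by linear_combination h1
  subst hp₁
  exact ⟨rfl, by linear_combination h2⟩

/-- The coefficient relations for a normalized `f` whose `exprH` is subordinate to `H(·, t)`. -/
lemma SubordExprH.exists_coeff {lam t : ℝ} {f : ℂ → ℂ} (hs : SubordExprH lam t f)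
    (hf : AnalyticAt ℂ f 0) {a₂ a₃ : ℂ} (hj : HasCubicJet f 0 1 a₂ a₃) :
    ∃ c₁ c₂ : ℂ, ‖c₁‖ ≤ 1 ∧ ‖c₂‖ ≤ 1 ∧ (1 + lam) * a₂ = 2 * t * c₁ ∧
      2 * (1 + 2 * lam) * a₃ - (1 + 3 * lam) * a₂ ^ 2 =
        2 * t * c₂ + (4 * t ^ 2 - 1) * c₁ ^ 2 := by
  obtain ⟨F, hF, hF₀, hFe, hsub⟩ := hs
  have hFj := (hF 0 zero_mem_unitD).hasCubicJet
  rw [hF₀] at hFj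
  obtain ⟨c₁, c₂, hc₁, hc₂, h₁, h₂⟩ := hsub.exists_coeff hFj
  refine ⟨c₁, c₂, hc₁, hc₂, ?_⟩
  rw [← h₁, ← h₂]
  generalize deriv F 0 = p₁ at *
  generalize iteratedDeriv 2 F 0 / 2 = p₂ at *
  obtain ⟨e, hj'⟩ := hj.deriv hf
  obtain ⟨e', hj''⟩ := hj'.deriv hf.deriv
  have hf₀ : f 0 = 0 := (hf.hasCubicJet.unique hj).1
  have hf₁ : deriv f 0 = 1 := (hf.hasCubicJet.unique hj).2.1
  have hfne : ∀ᶠ z in nhds 0, z ≠ 0 → f z ≠ 0 :=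
    eventually_nhdsWithin_iff.1
      (hf.differentiableAt.hasDerivAt.eventually_ne (by simp [hf₁]))
  have hdne : ∀ᶠ z in nhds 0, deriv f z ≠ 0 :=
    hf.deriv.continuousAt.eventually_ne (by simp [hf₁])
  have hL := hFj.mul (hj.mul hj')
  have hR := ((HasCubicJet.self.mul hj'.pow_two).const_mul (1 - (lam : ℂ))).add
    (((hj'.add (HasCubicJet.self.mul hj'')).mul hj).const_mul (lam : ℂ))
  have hR' := hR.congr (g := fun z ↦ F z * (f z * deriv f z)) (by
    filter_upwards [hfne, hdne, unitD_mem_nhds_zero] with z hfz hdz hzD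
    rcases eq_or_ne z 0 with rfl | hz
    · simp [hf₀]
    · have := hfz hz
      rw [hFe z hzD hz, exprH]
      field_simp)
  obtain ⟨-, -, h2, h3⟩ := hL.unique hR'
  have hp₁ : p₁ = (1 + lam) * a₂ := by linear_combination h2
  subst hp₁
  exact ⟨rfl, by linear_combination -h3⟩

theorem hsigma_a3_bound (lam t : ℝ) (hlam : 0 ≤ lam)
    (ht : t ∈ Set.Ioc (Real.sqrt 2 / 2) 1)
    (f : ℂ → ℂ) (hf : InHSigma lam t f)
    (a : ℕ → ℂ) (ha : ∀ n, a n = iteratedDeriv n f 0 / n.factorial) :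
    ‖a 3‖ ≤ 4 * t ^ 2 / (1 + lam) ^ 2 + t / (1 + 2 * lam) := by
  obtain ⟨g, ⟨hfa, hf₀, hf₁, -, hga, -, hgf, -⟩, hsf, hsg⟩ := hf
  have hf' := hfa 0 zero_mem_unitD
  have hg' := hga 0 zero_mem_unitD
  have hfj := hf'.hasCubicJet
  have ha₃ : iteratedDeriv 3 f 0 / 6 = a 3 := by simp [ha, Nat.factorial]
  rw [hf₀, hf₁, ha₃] at hfj
  generalize iteratedDeriv 2 f 0 / 2 = a₂ at hfj
  have hft : Filter.Tendsto f (nhds 0) (nhds 0) := by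
    simpa [hf₀] using hf'.continuousAt.tendsto
  have hgj := hg'.hasCubicJet
  have hid := HasCubicJet.self.congr (g := fun z ↦ g (f z)) (by
    filter_upwards [unitD_mem_nhds_zero, hft unitD_mem_nhds_zero] with z hz hfz
    exact hgf z hz hfz)
  obtain ⟨h0, h1, h2, h3⟩ := (hgj.comp hfj hft).unique hid
  have hb₂ : iteratedDeriv 2 g 0 / 2 = -a₂ := by linear_combination h2 - a₂ * h1
  rw [mul_one] at h1
  have hb₃ : iteratedDeriv 3 g 0 / 6 = 2 * a₂ ^ 2 - a 3 := by
    rw [h1, hb₂] at h3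
    linear_combination h3
  rw [h0, h1, hb₂, hb₃] at hgj
  obtain ⟨c₁, c₂, hc₁, hc₂, hc, hc'⟩ := hsf.exists_coeff hf' hfj
  obtain ⟨d₁, d₂, -, hd₂, hd, hd'⟩ := hsg.exists_coeff hg' hgj
  have ht0 : 0 < t := lt_trans (by positivity) ht.1
  have hdc : d₁ = -c₁ := by
    have : (2 * t : ℂ) ≠ 0 := by exact_mod_cast (by positivity : 2 * t ≠ 0)
    apply mul_left_cancel₀ this
    linear_combination -hd - hc
  subst hdc
  have hl₁ : 0 < 1 + lam := by positivity
  have hl₂ : 0 < 1 + 2 * lam := by positivity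
  have hl₁' : (1 + lam : ℂ) ≠ 0 := by exact_mod_cast hl₁.ne'
  have hl₂' : (1 + 2 * lam : ℂ) ≠ 0 := by exact_mod_cast hl₂.ne'
  have key : a 3 = ((4 * t ^ 2 / (1 + lam) ^ 2 : ℝ) : ℂ) * c₁ ^ 2 +
      ((t / (2 * (1 + 2 * lam)) : ℝ) : ℂ) * (c₂ - d₂) := by
    have hsq : a₂ = 2 * t * c₁ / (1 + lam) := by
      rw [eq_div_iff hl₁']
      linear_combination hc
    have hdiff : a 3 = a₂ ^ 2 + t * (c₂ - d₂) / (2 * (1 + 2 * lam)) := by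
      field_simp
      linear_combination (hc' - hd') / 2
    rw [hdiff, hsq]
    push_cast
    field_simp
    ring
  calc ‖a 3‖ ≤ 4 * t ^ 2 / (1 + lam) ^ 2 * ‖c₁‖ ^ 2 +
        t / (2 * (1 + 2 * lam)) * (‖c₂‖ + ‖d₂‖) := by
        rw [key]
        refine (norm_add_le _ _).trans ?_
        rw [norm_mul, norm_mul, norm_pow, Complex.norm_of_nonneg (by positivity),
          Complex.norm_of_nonneg (by positivity)]
        gcongr
        exact norm_sub_le _ _
    _ ≤ 4 * t ^ 2 / (1 + lam) ^ 2 * 1 ^ 2 + t / (2 * (1 + 2 * lam)) * (1 + 1) := by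
        gcongr
    _ = 4 * t ^ 2 / (1 + lam) ^ 2 + t / (1 + 2 * lam) := by
        field_simp
        ring
end

section
/- Let λ ≥ 0 and t ∈ (√2/2, 1], and let f ∈ H_Σ(λ,t) have Taylor coefficients aₙ = f⁽ⁿ⁾(0)/n!. Then |a₃ − a₂²| ≤ t/(1+2λ). -/
open Filter Topology Asymptotics

/-- Second-order expansion of `f` along the punctured neighbourhoods of `0`. -/
def HasJet (f : ℂ → ℂ) (a b c : ℂ) : Prop :=
  (fun z => f z - (a + b * z + c * z ^ 2)) =O[𝓝[≠] 0] fun z => z ^ 3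

namespace HasJet

variable {f g : ℂ → ℂ} {a b c a' b' c' : ℂ}

theorem congr (hf : HasJet f a b c) (h : f =ᶠ[𝓝[≠] 0] g) : HasJet g a b c :=
  IsBigO.congr' hf (h.mono fun z hz => by simp only [hz]) EventuallyEq.rfl

theorem tendsto (hf : HasJet f a b c) : Tendsto f (𝓝[≠] 0) (𝓝 a) := by
  have h3 : Tendsto (fun z : ℂ => z ^ 3) (𝓝[≠] 0) (𝓝 0) := by
    have : Continuous fun z : ℂ => z ^ 3 := by fun_prop
    simpa using (this.tendsto 0).mono_left nhdsWithin_le_nhds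
  have hp : Tendsto (fun z : ℂ => a + b * z + c * z ^ 2) (𝓝[≠] 0) (𝓝 a) := by
    have : Continuous fun z : ℂ => a + b * z + c * z ^ 2 := by fun_prop
    simpa using (this.tendsto 0).mono_left nhdsWithin_le_nhds
  simpa using (hf.trans_tendsto h3).add hp

theorem of_eq (h : ∀ z, f z = a + b * z + c * z ^ 2) : HasJet f a b c := by
  simp [HasJet, h, isBigO_zero]

theorem add (hf : HasJet f a b c) (hg : HasJet g a' b' c') :
    HasJet (fun z => f z + g z) (a + a') (b + b') (c + c') :=
  (IsBigO.add hf hg).congr_left fun z => by ring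

theorem mul (hf : HasJet f a b c) (hg : HasJet g a' b' c') :
    HasJet (fun z => f z * g z) (a * a') (a * b' + b * a') (a * c' + b * b' + c * a') := by
  have hg1 : g =O[𝓝[≠] 0] fun _ => (1 : ℂ) := hg.tendsto.isBigO_one ℂ
  have bdd : ∀ p : ℂ → ℂ, Continuous p → p =O[𝓝[≠] 0] fun _ => (1 : ℂ) := fun p hp =>
    ((hp.tendsto 0).mono_left nhdsWithin_le_nhds).isBigO_one ℂ
  have h1 := IsBigO.mul hf hg1
  have h2 := IsBigO.mul hg (bdd (fun z => a + b * z + c * z ^ 2) (by fun_prop))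
  have h3 := (isBigO_refl (fun z : ℂ => z ^ 3) (𝓝[≠] 0)).mul
    (bdd (fun z => b * c' + c * b' + c * c' * z) (by fun_prop))
  exact ((h1.add (h2.add h3)).congr_left fun z => by ring).congr_right fun z => by ring

theorem const_mul (k : ℂ) (hf : HasJet f a b c) :
    HasJet (fun z => k * f z) (k * a) (k * b) (k * c) := by
  simpa using (of_eq (f := fun _ => k) (a := k) (b := 0) (c := 0) (by simp)).mul hf

theorem id_mul (hf : HasJet f a b c) : HasJet (fun z => z * f z) 0 a b := by
  simpa using (of_eq (f := fun z => z) (a := 0) (b := 1) (c := 0) (by simp)).mul hf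

theorem comp (hg : HasJet g a' b' c') (hf : HasJet f 0 b c) (h0 : ∀ᶠ z in 𝓝[≠] 0, f z ≠ 0) :
    HasJet (fun z => g (f z)) a' (b' * b) (b' * c + c' * b ^ 2) := by
  have hf1 : f =O[𝓝[≠] 0] fun z => z := by
    have h3 : (fun z : ℂ => z ^ 3) =O[𝓝[≠] 0] fun z => z :=
      ((isBigO_refl (fun z : ℂ => z) (𝓝[≠] 0)).mul
        ((((continuous_pow 2).tendsto (0 : ℂ)).mono_left nhdsWithin_le_nhds).isBigO_one ℂ)).congr
        (fun z => by ring) (fun z => by ring)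
    have hp : (fun z : ℂ => b * z + c * z ^ 2) =O[𝓝[≠] 0] fun z => z := by
      have hc : Continuous fun z : ℂ => b + c * z := by fun_prop
      exact ((isBigO_refl (fun z : ℂ => z) (𝓝[≠] 0)).mul
        (((hc.tendsto (0 : ℂ)).mono_left nhdsWithin_le_nhds).isBigO_one ℂ)).congr
        (fun z => by ring) (fun z => by ring)
    exact ((IsBigO.trans hf h3).add hp).congr_left fun z => by ring
  have ht : Tendsto f (𝓝[≠] 0) (𝓝[≠] 0) := tendsto_nhdsWithin_iff.2 ⟨hf.tendsto, h0⟩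
  have h1 : (fun z => g (f z) - (a' + b' * f z + c' * f z ^ 2)) =O[𝓝[≠] 0] fun z => z ^ 3 :=
    (IsBigO.comp_tendsto hg ht).trans (hf1.pow 3)
  have hj := ((of_eq (f := fun _ => a') (a := a') (b := 0) (c := 0) (by simp)).add
    (hf.const_mul b')).add ((hf.mul hf).const_mul c')
  exact (h1.add hj).congr_left fun z => by ring

theorem unique (hf : HasJet f a b c) (hg : HasJet f a' b' c') : a = a' ∧ b = b' ∧ c = c' := by
  have ha : a = a' := tendsto_nhds_unique hf.tendsto hg.tendsto
  subst ha
  have hd : (fun z : ℂ => (b - b') * z + (c - c') * z ^ 2) =O[𝓝[≠] 0] fun z => z ^ 3 :=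
    (IsBigO.sub hg hf).congr_left fun z => by ring
  have hinv (u v : ℂ → ℂ) (h : (fun z => z * u z) =O[𝓝[≠] 0] fun z => z * v z) :
      u =O[𝓝[≠] 0] v := by
    refine ((isBigO_refl (fun z : ℂ => z⁻¹) (𝓝[≠] 0)).mul h).congr' ?_ ?_ <;>
    · filter_upwards [self_mem_nhdsWithin] with z hz
      have : z ≠ 0 := hz
      field_simp
  have hlim (p q : ℂ → ℂ) (hp : Continuous p) (hq : Continuous q) (hq0 : q 0 = 0)
      (h : p =O[𝓝[≠] 0] q) : p 0 = 0 :=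
    tendsto_nhds_unique ((hp.tendsto 0).mono_left nhdsWithin_le_nhds)
      (h.trans_tendsto (by simpa [hq0] using (hq.tendsto 0).mono_left nhdsWithin_le_nhds))
  have h1 := hinv (fun z => (b - b') + (c - c') * z) (fun z => z ^ 2)
    (hd.congr (fun z => by ring) (fun z => by ring))
  have hb : b - b' = 0 := by
    simpa using hlim _ _ (by fun_prop) (by fun_prop) (by simp) h1
  have h2 := hinv (fun _ => c - c') (fun z => z)
    (h1.congr (fun z => by rw [hb]; ring) (fun z => by ring))
  have hc : c - c' = 0 := by
    simpa using hlim _ _ (by fun_prop) (by fun_prop) (by simp) h2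
  exact ⟨rfl, sub_eq_zero.1 hb, sub_eq_zero.1 hc⟩

end HasJet

theorem AnalyticAt.isBigO_sub_taylor {f : ℂ → ℂ} (hf : AnalyticAt ℂ f 0) (n : ℕ) :
    (fun z => f z - ∑ k ∈ Finset.range n, iteratedDeriv k f 0 / k.factorial * z ^ k)
      =O[𝓝 0] fun z => z ^ n := by
  have h := hf.hasFPowerSeriesAt.isBigO_sub_partialSum_pow n
  refine (IsBigO.of_norm_right (g' := fun z : ℂ => z ^ n) ?_)
  simpa [FormalMultilinearSeries.partialSum, mul_comm] using h

theorem AnalyticAt.hasJet {f : ℂ → ℂ} (hf : AnalyticAt ℂ f 0) :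
    HasJet f (f 0) (deriv f 0) (iteratedDeriv 2 f 0 / 2) := by
  simpa [HasJet, Finset.sum_range_succ] using (hf.isBigO_sub_taylor 3).mono nhdsWithin_le_nhds

theorem AnalyticAt.hasJet_div_id {f : ℂ → ℂ} (hf : AnalyticAt ℂ f 0) (h0 : f 0 = 0) :
    HasJet (fun z => f z / z) (deriv f 0) (iteratedDeriv 2 f 0 / 2)
      (iteratedDeriv 3 f 0 / 6) := by
  have h := (hf.isBigO_sub_taylor 4).mono (nhdsWithin_le_nhds (s := {0}ᶜ))
  refine ((isBigO_refl (fun z : ℂ => z⁻¹) (𝓝[≠] 0)).mul h).congr' ?_ ?_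
  · filter_upwards [self_mem_nhdsWithin] with z hz
    have : z ≠ 0 := hz
    simp [Finset.sum_range_succ, h0, Nat.factorial]
    field_simp
  · filter_upwards [self_mem_nhdsWithin] with z hz
    have : z ≠ 0 := hz
    field_simp

theorem norm_iteratedDeriv_two_le_of_bounded {w : ℂ → ℂ}
    (hw : DifferentiableOn ℂ w (Metric.ball 0 1)) (hb : ∀ z ∈ Metric.ball (0 : ℂ) 1, ‖w z‖ ≤ 1) :
    ‖iteratedDeriv 2 w 0 / 2‖ ≤ 1 := by
  have key : ∀ r ∈ Set.Ioo (0 : ℝ) 1, ‖iteratedDeriv 2 w 0‖ * r ^ 2 ≤ 2 := fun r hr => by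
    have hsub : Metric.closedBall (0 : ℂ) r ⊆ Metric.ball 0 1 :=
      Metric.closedBall_subset_ball hr.2
    have := Complex.norm_iteratedDeriv_le_of_forall_mem_sphere_norm_le (n := 2) (c := 0)
      (C := 1) hr.1 ((hw.mono hsub).diffContOnCl_ball subset_rfl)
      fun z hz => hb z (hsub (Metric.sphere_subset_closedBall hz))
    rw [le_div_iff₀ (by have := hr.1; positivity)] at this
    simpa using this
  have hlim : Tendsto (fun r : ℝ => ‖iteratedDeriv 2 w 0‖ * r ^ 2) (𝓝[<] 1)
      (𝓝 (‖iteratedDeriv 2 w 0‖ * 1 ^ 2)) :=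
    ((by fun_prop : Continuous fun r : ℝ => ‖iteratedDeriv 2 w 0‖ * r ^ 2).tendsto 1).mono_left
      nhdsWithin_le_nhds
  have := le_of_tendsto hlim (eventually_of_mem (Ioo_mem_nhdsLT one_pos) key)
  rw [norm_div, Complex.norm_ofNat]
  linarith

theorem subordExprH_coeff {lam t : ℝ} {f : ℂ → ℂ} (hf : AnalyticAt ℂ f 0) (h0 : f 0 = 0)
    (h1 : deriv f 0 = 1) (hs : SubordExprH lam t f) :
    ∃ c d : ℂ, ‖d‖ ≤ 1 ∧ (1 + lam) * (iteratedDeriv 2 f 0 / 2) = 2 * t * c ∧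
      2 * (1 + 2 * lam) * (iteratedDeriv 3 f 0 / 6) -
        (1 + 3 * lam) * (iteratedDeriv 2 f 0 / 2) ^ 2 = 2 * t * d + (4 * t ^ 2 - 1) * c ^ 2 := by
  obtain ⟨F, hF, hF0, hFe, w, hw, hw0, hwb, hFw⟩ := hs
  have hD : unitD = Metric.ball 0 1 := by ext; simp [unitD]
  have h0D : (0 : ℂ) ∈ unitD := by simp [unitD]
  have hmem : ∀ᶠ z in 𝓝[≠] (0 : ℂ), z ∈ unitD :=
    nhdsWithin_le_nhds (hD ▸ Metric.ball_mem_nhds 0 one_pos)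
  refine ⟨deriv w 0, iteratedDeriv 2 w 0 / 2, norm_iteratedDeriv_two_le_of_bounded
    (hD ▸ hw.differentiableOn) (fun z hz => (hwb z (hD ▸ hz)).le), ?_⟩
  have jF := (hF 0 h0D).hasJet
  have jw := (hw 0 h0D).hasJet
  rw [hw0] at jw
  rw [hF0] at jF
  have jden := ((HasJet.of_eq (f := fun _ => 1) (a := 1) (b := 0) (c := 0) (by simp)).add
    (jw.const_mul (-2 * t))).add (jw.mul jw)
  have hden : ∀ᶠ z in 𝓝[≠] 0, 1 + -2 * t * w z + w z * w z ≠ 0 :=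
    jden.tendsto.eventually_ne (by simp)
  have e1 := ((jF.mul jden).congr (g := fun _ => 1) (by
    filter_upwards [hmem, hden] with z hz hz0
    rw [hFw z hz, Hker]
    have : 1 - 2 * (t : ℂ) * w z + w z ^ 2 ≠ 0 := by convert hz0 using 1; ring
    rw [div_mul_eq_mul_div, div_eq_one_iff_eq this]
    ring)).unique (HasJet.of_eq (a := 1) (b := 0) (c := 0) (by simp))
  have jq := hf.hasJet_div_id h0
  have jd := hf.deriv.hasJet
  have jdd := hf.deriv.deriv.hasJet.id_mul
  rw [h1] at jq jd
  have s2 : iteratedDeriv 2 f 0 = deriv (deriv f) 0 := by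
    rw [iteratedDeriv_succ', iteratedDeriv_one]
  have s3 : iteratedDeriv 3 f 0 = iteratedDeriv 2 (deriv f) 0 := by rw [iteratedDeriv_succ']
  have s3' : deriv (deriv (deriv f)) 0 = iteratedDeriv 2 (deriv f) 0 := by
    rw [iteratedDeriv_succ', iteratedDeriv_one]
  rw [s2, s3] at jq
  rw [s3'] at jdd
  have e2 := ((jF.mul (jq.mul jd)).congr
    (g := fun z => (1 - (lam : ℂ)) * (deriv f z * deriv f z) +
      lam * (f z / z * (deriv f z + z * deriv (deriv f) z))) (by
    filter_upwards [hmem, self_mem_nhdsWithin, jq.tendsto.eventually_ne one_ne_zero,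
      jd.tendsto.eventually_ne one_ne_zero] with z hz hz0 hq hd
    have hz0 : z ≠ 0 := hz0
    have hfz : f z ≠ 0 := fun h => hq (by simp [h])
    rw [hFe z hz hz0, exprH]
    field_simp)).unique
      (((jd.mul jd).const_mul (1 - (lam : ℂ))).add ((jq.mul (jd.add jdd)).const_mul (lam : ℂ)))
  rw [s2, s3]
  generalize deriv (deriv f) 0 = A at *
  generalize iteratedDeriv 2 (deriv f) 0 = B at *
  generalize deriv F 0 = p at *
  generalize iteratedDeriv 2 F 0 / 2 = q at *
  generalize deriv w 0 = c at *
  generalize iteratedDeriv 2 w 0 / 2 = d at *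
  obtain ⟨-, e11, e12⟩ := e1
  obtain ⟨-, e21, e22⟩ := e2
  have hp : p = 2 * t * c := by linear_combination e11
  have hp' : p = (1 + lam) * (A / 2) := by linear_combination e21
  refine ⟨hp' ▸ hp, ?_⟩
  have hq : q = 2 * t * d + (4 * t ^ 2 - 1) * c ^ 2 := by
    rw [hp] at e12; linear_combination e12
  rw [← hq]
  rw [hp'] at e22
  linear_combination -e22

theorem inverse_coeff {f g : ℂ → ℂ} (hf : AnalyticAt ℂ f 0) (hg : AnalyticAt ℂ g 0)
    (f0 : f 0 = 0) (f1 : deriv f 0 = 1) (hgf : ∀ᶠ z in 𝓝 0, g (f z) = z) :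
    g 0 = 0 ∧ deriv g 0 = 1 ∧ iteratedDeriv 2 g 0 / 2 = -(iteratedDeriv 2 f 0 / 2) ∧
      iteratedDeriv 3 g 0 / 6 = 2 * (iteratedDeriv 2 f 0 / 2) ^ 2 - iteratedDeriv 3 f 0 / 6 := by
  have g0 : g 0 = 0 := by simpa [f0] using hgf.self_of_nhds
  have jq := hf.hasJet_div_id f0
  have jf := hf.hasJet
  have jg := hg.hasJet_div_id g0
  rw [f1] at jq jf
  rw [f0] at jf
  have hne : ∀ᶠ z in 𝓝[≠] 0, f z ≠ 0 := by
    filter_upwards [jq.tendsto.eventually_ne one_ne_zero] with z hq h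
    exact hq (by simp [h])
  obtain ⟨h1, h2, h3⟩ := ((jq.mul (jg.comp jf hne)).congr (g := fun _ => 1) (by
    filter_upwards [hne, self_mem_nhdsWithin, nhdsWithin_le_nhds hgf] with z hz hz0 hi
    have hz0 : z ≠ 0 := hz0
    rw [hi]
    field_simp)).unique (HasJet.of_eq (a := 1) (b := 0) (c := 0) (by simp))
  have g1 : deriv g 0 = 1 := by linear_combination h1
  rw [g1] at h2 h3
  have g2 : iteratedDeriv 2 g 0 / 2 = -(iteratedDeriv 2 f 0 / 2) := by linear_combination h2
  refine ⟨g0, g1, g2, ?_⟩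
  rw [g2] at h3
  linear_combination h3

theorem hsigma_fekete_szego_one (lam t : ℝ) (hlam : 0 ≤ lam)
    (ht : t ∈ Set.Ioc (Real.sqrt 2 / 2) 1)
    (f : ℂ → ℂ) (hf : InHSigma lam t f)
    (a : ℕ → ℂ) (ha : ∀ n, a n = iteratedDeriv n f 0 / n.factorial) :
    ‖a 3 - (a 2) ^ 2‖ ≤ t / (1 + 2 * lam) := by
  obtain ⟨g, ⟨hfa, f0, f1, -, hga, -, hgf, -⟩, hsf, hsg⟩ := hf
  have t0 : 0 < t := lt_of_le_of_lt (by positivity) ht.1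
  have h0D : (0 : ℂ) ∈ unitD := by simp [unitD]
  have hD : unitD ∈ 𝓝 (0 : ℂ) := by
    convert Metric.ball_mem_nhds (0 : ℂ) one_pos using 1
    ext; simp [unitD]
  have hfD : ∀ᶠ z in 𝓝 0, f z ∈ unitD :=
    (hfa 0 h0D).continuousAt.eventually_mem (by rwa [f0])
  have hinv : ∀ᶠ z in 𝓝 0, g (f z) = z := by
    filter_upwards [hD, hfD] with z hz hfz using hgf z hz hfz
  obtain ⟨g0, g1, g2, g3⟩ := inverse_coeff (hfa 0 h0D) (hga 0 h0D) f0 f1 hinv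
  obtain ⟨c, d, hd, e1, e2⟩ := subordExprH_coeff (hfa 0 h0D) f0 f1 hsf
  obtain ⟨c', d', hd', e1', e2'⟩ := subordExprH_coeff (hga 0 h0D) g0 g1 hsg
  rw [g2] at e1' e2'
  rw [g3] at e2'
  have ha2 : a 2 = iteratedDeriv 2 f 0 / 2 := by simp [ha]
  have ha3 : a 3 = iteratedDeriv 3 f 0 / 6 := by simp [ha, Nat.factorial]
  rw [← ha2] at e1 e2 e1' e2'
  rw [← ha3] at e2 e2'
  have ht' : (t : ℂ) ≠ 0 := by exact_mod_cast t0.ne'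
  have hc : c' = -c := by
    apply mul_left_cancel₀ (mul_ne_zero two_ne_zero ht')
    linear_combination -e1 - e1'
  rw [hc] at e2'
  have key : (((1 + 2 * lam : ℝ) : ℂ)) * (a 3 - a 2 ^ 2) * 2 = t * (d - d') := by
    push_cast
    linear_combination (e2 - e2') / 2
  have hn := congrArg norm key
  have hl : 0 < 1 + 2 * lam := by positivity
  rw [norm_mul, norm_mul, norm_mul, Complex.norm_real, Complex.norm_real, Real.norm_of_nonneg hl.le,
    Real.norm_of_nonneg t0.le, Complex.norm_ofNat] at hn
  have hdd : ‖d - d'‖ ≤ 2 := (norm_sub_le d d').trans (by linarith)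
  rw [le_div_iff₀ hl]
  nlinarith
end

section
/- Let λ ≥ 0 and t ∈ ℝ. Let g be analytic on D with g(0) = 0, g'(0) = 1, and g(w) ≠ 0, g'(w) ≠ 0 for 0 < |w| < 1; suppose the Taylor coefficients of g satisfy g''(0)/2! = −a₂ and g'''(0)/3! = 2a₂² − a₃ for complex numbers a₂, a₃. Let v be analytic on D with v(0) = 0 and |v(w)| < 1 on D; write dₙ = v⁽ⁿ⁾(0)/n!. If (1−λ)·w g'(w)/g(w) + λ·(1 + w g''(w)/g'(w)) = 1/(1 − 2t·v(w) + v(w)²) for all w ∈ D with w ≠ 0, then −(1+λ)·a₂ = 2t·d₁ and 2(1+2λ)·(2a₂² − a₃) − (1+3λ)·a₂² = 2t·d₂ + (4t² − 1)·d₁². -/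
open Filter Topology

/-- `f` agrees with `a + b w + c w ^ 2` up to `o(w ^ 2)` on a punctured neighbourhood of `0`. -/
def HasTwoJet (f : ℂ → ℂ) (a b c : ℂ) : Prop :=
  ∃ r : ℂ → ℂ, Tendsto r (𝓝[≠] 0) (𝓝 0) ∧
    ∀ᶠ w in 𝓝[≠] (0 : ℂ), f w = a + b * w + c * w ^ 2 + w ^ 2 * r w

namespace HasTwoJet

variable {f g : ℂ → ℂ} {a b c a' b' c' : ℂ}

theorem tendsto_id_punctured : Tendsto (fun w : ℂ => w) (𝓝[≠] 0) (𝓝 0) :=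
  tendsto_id.mono_left nhdsWithin_le_nhds

theorem of_polynomial (a b c : ℂ) : HasTwoJet (fun w => a + b * w + c * w ^ 2) a b c :=
  ⟨0, tendsto_const_nhds, Eventually.of_forall fun w => by simp⟩

theorem const (a : ℂ) : HasTwoJet (fun _ => a) a 0 0 := by
  simpa using of_polynomial a 0 0

theorem id : HasTwoJet (fun w => w) 0 1 0 := by
  simpa using of_polynomial 0 1 0

theorem congr' (hf : HasTwoJet f a b c) (h : f =ᶠ[𝓝[≠] 0] g) : HasTwoJet g a b c := by
  obtain ⟨r, hr, hfr⟩ := hf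
  refine ⟨r, hr, ?_⟩
  filter_upwards [hfr, h] with w h₁ h₂
  rw [← h₂, h₁]

theorem add (hf : HasTwoJet f a b c) (hg : HasTwoJet g a' b' c') :
    HasTwoJet (fun w => f w + g w) (a + a') (b + b') (c + c') := by
  obtain ⟨r, hr, hfr⟩ := hf
  obtain ⟨s, hs, hgs⟩ := hg
  refine ⟨fun w => r w + s w, by simpa using hr.add hs, ?_⟩
  filter_upwards [hfr, hgs] with w h₁ h₂
  rw [h₁, h₂]
  ring

theorem mul (hf : HasTwoJet f a b c) (hg : HasTwoJet g a' b' c') :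
    HasTwoJet (fun w => f w * g w) (a * a') (a * b' + b * a') (a * c' + b * b' + c * a') := by
  obtain ⟨r, hr, hfr⟩ := hf
  obtain ⟨s, hs, hgs⟩ := hg
  have hw := tendsto_id_punctured
  refine ⟨fun w => w * (b * c' + c * b' + c * c' * w) + r w * (a' + b' * w + c' * w ^ 2) +
      s w * (a + b * w + c * w ^ 2) + w ^ 2 * (r w * s w), ?_, ?_⟩
  · have h := (((hw.mul ((hw.const_mul (c * c')).const_add (b * c' + c * b'))).add
      (hr.mul (((hw.const_mul b').const_add a').add ((hw.pow 2).const_mul c')))).add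
      (hs.mul (((hw.const_mul b).const_add a).add ((hw.pow 2).const_mul c)))).add
      ((hw.pow 2).mul (hr.mul hs))
    simpa using h
  · filter_upwards [hfr, hgs] with w h₁ h₂
    rw [h₁, h₂]
    ring

theorem tendsto (hf : HasTwoJet f a b c) : Tendsto f (𝓝[≠] 0) (𝓝 a) := by
  obtain ⟨r, hr, hfr⟩ := hf
  have hw := tendsto_id_punctured
  have h := (((hw.const_mul b).const_add a).add ((hw.pow 2).const_mul c)).add ((hw.pow 2).mul hr)
  refine Tendsto.congr' (hfr.mono fun w h => h.symm) ?_
  simpa using h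

theorem eq_zero (h : HasTwoJet (fun _ => 0) a b c) : a = 0 ∧ b = 0 ∧ c = 0 := by
  have ha : a = 0 := tendsto_nhds_unique h.tendsto tendsto_const_nhds
  obtain ⟨r, hr, hfr⟩ := h
  have hw := tendsto_id_punctured
  have hne : ∀ᶠ w in 𝓝[≠] (0 : ℂ), w ≠ 0 := eventually_mem_nhdsWithin
  subst ha
  have hb : b = 0 := by
    have h := ((hw.const_mul c).const_add b).add (hw.mul hr)
    simp only [mul_zero, add_zero] at h
    refine tendsto_nhds_unique h (Tendsto.congr' ?_ tendsto_const_nhds)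
    filter_upwards [hfr, hne] with w h₁ h₂
    refine mul_left_cancel₀ h₂ ?_
    linear_combination h₁
  subst hb
  refine ⟨rfl, rfl, ?_⟩
  have h := hr.const_add c
  simp only [add_zero] at h
  refine tendsto_nhds_unique h (Tendsto.congr' ?_ tendsto_const_nhds)
  filter_upwards [hfr, hne] with w h₁ h₂
  refine mul_left_cancel₀ (pow_ne_zero 2 h₂) ?_
  linear_combination h₁

theorem unique (h : HasTwoJet f a b c) (h' : HasTwoJet f a' b' c') :
    a = a' ∧ b = b' ∧ c = c' := by
  have key := (h.add ((const (-1)).mul h')).congr'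
    (g := fun _ => 0) (Eventually.of_forall fun w => by ring)
  obtain ⟨h₀, h₁, h₂⟩ := key.eq_zero
  refine ⟨?_, ?_, ?_⟩
  · linear_combination h₀
  · linear_combination h₁
  · linear_combination h₂

theorem of_hasFPowerSeriesAt {p : FormalMultilinearSeries ℂ ℂ ℂ} (hp : HasFPowerSeriesAt f p 0) :
    HasTwoJet f (p.coeff 0) (p.coeff 1) (p.coeff 2) := by
  have hO := hp.isBigO_sub_partialSum_pow 3
  simp only [zero_add] at hO
  have ho : (fun w => f w - p.partialSum 3 w) =o[𝓝[≠] 0] fun w : ℂ => w ^ 2 := by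
    refine (hO.trans_isLittleO ?_).mono nhdsWithin_le_nhds
    have := (Asymptotics.isLittleO_pow_pow (𝕜 := ℂ) (m := 2) (n := 3) (by norm_num)).norm_left
    simpa using this
  refine ⟨fun w => (f w - p.partialSum 3 w) / w ^ 2, ho.tendsto_div_nhds_zero, ?_⟩
  filter_upwards [eventually_mem_nhdsWithin] with w hw
  have hw : w ≠ 0 := hw
  rw [mul_div_cancel₀ _ (pow_ne_zero 2 hw)]
  simp only [FormalMultilinearSeries.partialSum, Finset.sum_range_succ, Finset.sum_range_zero,
    FormalMultilinearSeries.apply_eq_pow_smul_coeff, smul_eq_mul]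
  ring

theorem of_analyticAt (hf : AnalyticAt ℂ f 0) :
    HasTwoJet f (f 0) (deriv f 0) (iteratedDeriv 2 f 0 / 2) := by
  simpa [FormalMultilinearSeries.coeff_ofScalars, iteratedDeriv_one] using
    of_hasFPowerSeriesAt hf.hasFPowerSeriesAt

theorem div_id_of_analyticAt (hf : AnalyticAt ℂ f 0) (h₀ : f 0 = 0) :
    HasTwoJet (fun w => f w / w) (deriv f 0) (iteratedDeriv 2 f 0 / 2)
      (iteratedDeriv 3 f 0 / 6) := by
  have h := of_hasFPowerSeriesAt hf.hasFPowerSeriesAt.has_fpower_series_dslope_fslope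
  simp only [FormalMultilinearSeries.coeff_fslope, FormalMultilinearSeries.coeff_ofScalars] at h
  refine HasTwoJet.congr' (by simpa [iteratedDeriv_one, Nat.factorial] using h) ?_
  filter_upwards [eventually_mem_nhdsWithin] with w hw
  rw [dslope_of_ne _ hw, slope_def_field]
  simp [h₀]

end HasTwoJet

theorem coeff_relations_g (lam t : ℝ) (hlam : 0 ≤ lam)
    (g : ℂ → ℂ) (hg : AnalyticOnNhd ℂ g unitD) (hg0 : g 0 = 0) (hg1 : deriv g 0 = 1)
    (hgne : ∀ w : ℂ, 0 < ‖w‖ → ‖w‖ < 1 → g w ≠ 0)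
    (hgne' : ∀ w : ℂ, 0 < ‖w‖ → ‖w‖ < 1 → deriv g w ≠ 0)
    (a2 a3 : ℂ)
    (hga2 : iteratedDeriv 2 g 0 / (Nat.factorial 2) = -a2)
    (hga3 : iteratedDeriv 3 g 0 / (Nat.factorial 3) = 2 * a2 ^ 2 - a3)
    (v : ℂ → ℂ) (hv : AnalyticOnNhd ℂ v unitD) (hv0 : v 0 = 0)
    (hvlt : ∀ w ∈ unitD, ‖v w‖ < 1)
    (d : ℕ → ℂ) (hd : ∀ n, d n = iteratedDeriv n v 0 / n.factorial)
    (heq : ∀ w ∈ unitD, w ≠ 0 →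
      (1 - (lam : ℂ)) * (w * deriv g w / g w) +
        (lam : ℂ) * (1 + w * deriv (deriv g) w / deriv g w) =
      1 / (1 - 2 * (t : ℂ) * v w + (v w) ^ 2)) :
    -((1 + (lam : ℂ)) * a2) = 2 * (t : ℂ) * d 1 ∧
    2 * (1 + 2 * (lam : ℂ)) * (2 * a2 ^ 2 - a3) - (1 + 3 * (lam : ℂ)) * a2 ^ 2 =
      2 * (t : ℂ) * d 2 + (4 * (t : ℂ) ^ 2 - 1) * (d 1) ^ 2 := by
  have h0 : (0 : ℂ) ∈ unitD := by simp [unitD]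
  have hD : ∀ᶠ w in 𝓝[≠] (0 : ℂ), w ∈ unitD := by
    refine nhdsWithin_le_nhds ?_
    have : unitD = Metric.ball 0 1 := by ext; simp [unitD]
    rw [this]
    exact Metric.ball_mem_nhds 0 one_pos
  have hgA := hg 0 h0
  have jG := HasTwoJet.div_id_of_analyticAt hgA hg0
  have jG' := HasTwoJet.of_analyticAt hgA.deriv
  have jN := HasTwoJet.id.mul (HasTwoJet.of_analyticAt hgA.deriv.deriv)
  have jV := HasTwoJet.of_analyticAt (hv 0 h0)
  have e2 : deriv (deriv g) 0 = -2 * a2 := by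
    have h : iteratedDeriv 2 g 0 = deriv (deriv g) 0 := by
      rw [iteratedDeriv_succ, iteratedDeriv_one]
    rw [h] at hga2
    norm_num [Nat.factorial] at hga2
    linear_combination 2 * hga2
  have i2 : iteratedDeriv 2 g 0 = -2 * a2 := by
    norm_num [Nat.factorial] at hga2
    linear_combination 2 * hga2
  have i3 : iteratedDeriv 3 g 0 = 6 * (2 * a2 ^ 2 - a3) := by
    norm_num [Nat.factorial] at hga3
    linear_combination 6 * hga3
  have i2' : iteratedDeriv 2 (deriv g) 0 = 6 * (2 * a2 ^ 2 - a3) := by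
    rw [← i3, ← iteratedDeriv_succ']
  have e3 : deriv (deriv (deriv g)) 0 = 6 * (2 * a2 ^ 2 - a3) := by
    rw [← i2', iteratedDeriv_succ, iteratedDeriv_one]
  have d1 : deriv v 0 = d 1 := by simp [hd, iteratedDeriv_one]
  have d2 : iteratedDeriv 2 v 0 / 2 = d 2 := by simp [hd]
  rw [hg1, i2, i3] at jG
  rw [hg1, e2, i2'] at jG'
  rw [e2, e3] at jN
  rw [hv0, d1, d2] at jV
  have jQ := ((HasTwoJet.const 1).add ((HasTwoJet.const (-2 * t)).mul jV)).add (jV.mul jV)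
  have jL := ((((HasTwoJet.const (1 - (lam : ℂ))).mul (jG'.mul jG')).add
    ((HasTwoJet.const (lam : ℂ)).mul (jG.mul (jG'.add jN))))).mul jQ
  have hQ : ∀ᶠ w in 𝓝[≠] (0 : ℂ), 1 + -2 * (t : ℂ) * v w + v w * v w ≠ 0 :=
    jQ.tendsto.eventually_ne (by simp)
  have hLR := jL.congr' (g := fun w => g w / w * deriv g w) (by
    filter_upwards [hD, hQ, eventually_mem_nhdsWithin] with w hw hq hne
    have hne : w ≠ 0 := hne
    have hgw := hgne w (norm_pos_iff.2 hne) hw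
    have hgw' := hgne' w (norm_pos_iff.2 hne) hw
    have h := heq w hw hne
    have hq' : 1 - 2 * (t : ℂ) * v w + v w ^ 2 ≠ 0 := by
      convert hq using 1
      ring
    rw [eq_div_iff hq'] at h
    have hmul := congrArg (fun z => g w / w * deriv g w * z) h
    simp only [mul_one] at hmul
    rw [← hmul]
    field_simp
    ring)
  obtain ⟨-, h₁, h₂⟩ := hLR.unique (jG.mul jG')
  have k₁ : -((1 + (lam : ℂ)) * a2) = 2 * (t : ℂ) * d 1 := by
    linear_combination h₁
  refine ⟨k₁, ?_⟩
  linear_combination h₂ + (3 * a2 + 2 * t * d 1) * k₁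
end
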